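/- arXiv:1606.03607 — 3 statements merged into one kernel-verified Lean document; each statement's English description precedes it below -/
import Mathlib

section
/- Let G be a finite group. The super class functions ω_{G/H}, as H ranges over a set of representatives of the conjugacy classes of subgroups of G, form a ℤ-basis of the group C(G) of super class functions: every super class function on G is a unique ℤ-linear combination of the functions ω_{G/H}. -/
open scoped Classical

/-- The conjugate `gHg⁻¹` of a subgroup `H`. -/
def conjSub {G : Type*} [Group G] (g : G) (H : Subgroup G) : Subgroup G :=
  H.map (MulAut.conj g).toMonoidHom

/-- A super class function: a function from subgroups of `G` to `ℤ` which is
constant on conjugacy classes of subgroups. -/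
def IsSuperClassFun (G : Type*) [Group G] (f : Subgroup G → ℤ) : Prop :=
  ∀ (g : G) (H : Subgroup G), f (conjSub g H) = f H

/-- The super class function `ω_X` of a `G`-set `X`: `ω_X(K) = 1` if `X^K ≠ ∅`
and `ω_X(K) = 0` otherwise. -/
noncomputable def omegaFn (G : Type*) [Group G] (X : Type*) [MulAction G X]
    (K : Subgroup G) : ℤ :=
  if ∃ x : X, ∀ k ∈ K, k • x = x then 1 else 0

/-- `K` is subconjugate to `H` if some conjugate of `K` is contained in `H`. -/
def Subconj {G : Type*} [Group G] (K H : Subgroup G) : Prop :=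
  ∃ g : G, conjSub g K ≤ H

theorem conjSub_conjSub {G : Type*} [Group G] (g h : G) (H : Subgroup G) :
    conjSub g (conjSub h H) = conjSub (g * h) H := by
  simp only [conjSub, Subgroup.map_map]
  congr 1
  ext x
  simp [mul_assoc]

theorem conjSub_one {G : Type*} [Group G] (H : Subgroup G) : conjSub 1 H = H := by
  ext x
  simp [conjSub]

theorem card_conjSub {G : Type*} [Group G] (g : G) (H : Subgroup G) :
    Nat.card (conjSub g H) = Nat.card H :=
  Subgroup.card_map_of_injective (MulAut.conj g).injective

theorem exists_fixed_conjSub {G : Type*} [Group G] {X : Type*} [MulAction G X] (g : G)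
    {K : Subgroup G} (h : ∃ x : X, ∀ k ∈ K, k • x = x) :
    ∃ x : X, ∀ k ∈ conjSub g K, k • x = x := by
  obtain ⟨x, hx⟩ := h
  refine ⟨g • x, ?_⟩
  rintro _ ⟨k, hk, rfl⟩
  simp [mul_smul, hx k hk]

theorem isSuperClassFun_omegaFn (G : Type*) [Group G] (X : Type*) [MulAction G X] :
    IsSuperClassFun G (omegaFn G X) := by
  intro g K
  have h : (∃ x : X, ∀ k ∈ conjSub g K, k • x = x) ↔ ∃ x : X, ∀ k ∈ K, k • x = x := by
    refine ⟨fun h => ?_, exists_fixed_conjSub g⟩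
    simpa [conjSub_conjSub, conjSub_one] using exists_fixed_conjSub g⁻¹ h
  simp only [omegaFn, h]

theorem omegaFn_quotient_self {G : Type*} [Group G] (H : Subgroup G) :
    omegaFn G (G ⧸ H) H = 1 := by
  refine if_pos ⟨((1 : G) : G ⧸ H), fun k hk => ?_⟩
  rw [MulAction.Quotient.smul_coe, eq_comm, QuotientGroup.eq]
  simpa using hk

theorem subconj_of_omegaFn_quotient_ne_zero {G : Type*} [Group G] {K H : Subgroup G}
    (h : omegaFn G (G ⧸ H) K ≠ 0) : Subconj K H := by
  have h' : ∃ x : G ⧸ H, ∀ k ∈ K, k • x = x := by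
    by_contra hn
    exact h (if_neg hn)
  obtain ⟨x, hx⟩ := h'
  obtain ⟨g, rfl⟩ := QuotientGroup.mk_surjective x
  refine ⟨g⁻¹, ?_⟩
  rintro _ ⟨k, hk, rfl⟩
  have := hx k hk
  rw [MulAction.Quotient.smul_coe, eq_comm, QuotientGroup.eq] at this
  simpa [mul_assoc] using this

theorem Subconj.conj_or_card_lt {G : Type*} [Group G] [Finite G] {K H : Subgroup G}
    (h : Subconj K H) : (∃ g : G, conjSub g K = H) ∨ Nat.card K < Nat.card H := by
  obtain ⟨g, hg⟩ := h
  rcases hg.eq_or_lt with h | h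
  · exact Or.inl ⟨g, h⟩
  · right
    rw [← card_conjSub g K]
    exact lt_of_not_ge fun hc => h.ne (Subgroup.eq_of_le_of_card_ge hg hc)

/-- A unitriangular system of linear equations over a commutative ring, indexed by a finite set,
has exactly one solution. -/
theorem existsUnique_solution_of_unitriangular {α R : Type*} [CommRing R] (r : α → ℕ)
    (M : α → α → R) (f : α → R) (s : Finset α) (h1 : ∀ a ∈ s, M a a = 1)
    (h2 : ∀ a ∈ s, ∀ b ∈ s, M a b ≠ 0 → a = b ∨ r a < r b) :
    ∃! c : α → R, (∀ a ∉ s, c a = 0) ∧ ∀ a ∈ s, f a = ∑ b ∈ s, c b * M a b := by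
  induction s using Finset.induction_on_min_value r with
  | empty => exact ⟨0, by simp, fun c hc => funext fun a => hc.1 a (by simp)⟩
  | insert a s ha hmin ih =>
    obtain ⟨c, ⟨hc0, hc⟩, huniq⟩ := ih (fun b hb => h1 b (Finset.mem_insert_of_mem hb))
      (fun b hb d hd => h2 b (Finset.mem_insert_of_mem hb) d (Finset.mem_insert_of_mem hd))
    have haa := h1 a (Finset.mem_insert_self a s)
    have hz : ∀ b ∈ s, M b a = 0 := by
      intro b hb
      by_contra hn
      rcases h2 b (Finset.mem_insert_of_mem hb) a (Finset.mem_insert_self a s) hn with h | h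
      · exact ha (h ▸ hb)
      · exact absurd h (hmin b hb).not_gt
    have hne : ∀ b ∈ s, b ≠ a := fun b hb h => ha (h ▸ hb)
    have hsum : ∀ (d : α → R) (v : R) (e : α),
        ∑ b ∈ s, Function.update d a v b * M e b = ∑ b ∈ s, d b * M e b := fun d v e =>
      Finset.sum_congr rfl fun b hb => by rw [Function.update_of_ne (hne b hb)]
    refine ⟨Function.update c a (f a - ∑ b ∈ s, c b * M a b), ⟨?_, ?_⟩, ?_⟩
    · intro b hb
      rw [Finset.mem_insert, not_or] at hb
      rw [Function.update_of_ne hb.1, hc0 b hb.2]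
    · intro e he
      rw [Finset.sum_insert ha, hsum, Function.update_self]
      rcases Finset.mem_insert.1 he with rfl | he
      · rw [haa]; ring
      · rw [hz e he, ← hc e he]; ring
    · rintro d ⟨hd0, hd⟩
      have hdc : Function.update d a 0 = c := by
        refine huniq _ ⟨fun b hb => ?_, fun b hb => ?_⟩
        · by_cases hba : b = a
          · rw [hba, Function.update_self]
          · rw [Function.update_of_ne hba]
            exact hd0 b (by simp [hba, hb])
        · rw [hsum, hd b (Finset.mem_insert_of_mem hb), Finset.sum_insert ha, hz b hb]
          ring
      have hda := hd a (Finset.mem_insert_self a s)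
      rw [Finset.sum_insert ha, haa] at hda
      rw [← hdc, hsum, Function.update_idem, hda]
      simp

theorem stmt12 (G : Type) [Group G] [Finite G] (reps : Finset (Subgroup G))
    (hreps : ∀ K : Subgroup G, ∃! H, H ∈ reps ∧ ∃ g : G, conjSub g K = H)
    (f : Subgroup G → ℤ) (hf : IsSuperClassFun G f) :
    ∃! c : Subgroup G → ℤ,
      (∀ H ∉ reps, c H = 0) ∧
        ∀ K : Subgroup G, f K = ∑ H ∈ reps, c H * omegaFn G (G ⧸ H) K := by
  have key := existsUnique_solution_of_unitriangular (fun H : Subgroup G => Nat.card H)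
    (fun K H => omegaFn G (G ⧸ H) K) f reps (fun H _ => omegaFn_quotient_self H) (by
      intro K hK H hH h
      refine (subconj_of_omegaFn_quotient_ne_zero h).conj_or_card_lt.imp_left fun hg => ?_
      exact (hreps K).unique ⟨hK, 1, conjSub_one K⟩ ⟨hH, hg⟩)
  refine (existsUnique_congr fun c => and_congr_right fun _ => ?_).1 key
  refine ⟨fun h K => ?_, fun h K _ => h K⟩
  obtain ⟨_, ⟨hH, g, rfl⟩, -⟩ := hreps K
  have hK := h _ hH
  rw [hf g K] at hK
  rw [hK]
  exact Finset.sum_congr rfl fun H _ => by rw [isSuperClassFun_omegaFn G (G ⧸ H) g K]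
end

section
/- Let H and K be finite groups, U a finite (H,K)-biset, X a K-poset, and L ≤ H a subgroup. For u ∈ U let L^u = {k ∈ K : u·k = l·u for some l ∈ L}, a subgroup of K. Let u_1, …, u_r be representatives of the orbits of U under the combined left L-action and right K-action. Then the map f ↦ (f(u_1), …, f(u_r)) is an order isomorphism from the L-fixed-point subposet of t_U(cX) onto the product poset ∏_{i=1}^{r} (cX)^{L^{u_i}}, where (cX)^{L^{u_i}} denotes the L^{u_i}-fixed-point subposet of cX. -/
open MulOpposite

universe u

section Defs

/-! `cX` is modelled by `WithBot X`, the poset `X` with a new bottom element `0_X`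
adjoined.  A group acting on `X` by order automorphisms acts on `WithBot X`
fixing the bottom element. -/

variable {K : Type u} [Group K] {X : Type u}

instance withBotSMul [SMul K X] : SMul K (WithBot X) :=
  ⟨fun k x => WithBot.map (k • ·) x⟩

theorem withBot_smul_def [SMul K X] (k : K) (x : WithBot X) :
    k • x = WithBot.map (k • ·) x := rfl

instance withBotMulAction [MulAction K X] : MulAction K (WithBot X) where
  one_smul x := by
    cases x with
    | bot => rfl
    | coe a => show WithBot.map _ _ = _; simp
  mul_smul g h x := by
    cases x with
    | bot => rfl
    | coe a =>
        show WithBot.map _ _ = WithBot.map _ (WithBot.map _ _)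
        simp [mul_smul]

end Defs

/-- `t_U(cX)`: the set of maps `f : U → cX` with `f (u·k) = k⁻¹ • f u`,
ordered pointwise.  Here the right `K`-action on `U` is encoded as a left
`Kᵐᵒᵖ`-action. -/
def tU (K : Type u) [Group K] (U : Type u) [MulAction Kᵐᵒᵖ U]
    (X : Type u) [PartialOrder X] [MulAction K X] : Type u :=
  {f : U → WithBot X // ∀ (u : U) (k : K), f (op k • u) = k⁻¹ • f u}

variable (H K : Type u) [Group H] [Group K]
variable (U : Type u) [MulAction Kᵐᵒᵖ U]
variable (X : Type u) [PartialOrder X] [MulAction K X]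

instance : PartialOrder (tU K U X) := by unfold tU; infer_instance

/-- The left `H`-action `(h • f) u = f (h⁻¹ • u)` on `t_U(cX)`, for an
`(H,K)`-biset `U`. -/
instance tUSMul [MulAction H U] [SMulCommClass H Kᵐᵒᵖ U] : SMul H (tU K U X) :=
  ⟨fun h f => ⟨fun u => f.1 (h⁻¹ • u), fun u k => by
    show f.1 (h⁻¹ • (op k • u)) = k⁻¹ • f.1 (h⁻¹ • u)
    rw [smul_comm, f.2]⟩⟩

theorem tU_smul_def [MulAction H U] [SMulCommClass H Kᵐᵒᵖ U] (h : H)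
    (f : tU K U X) (u : U) : (h • f).1 u = f.1 (h⁻¹ • u) := rfl

instance tUMulAction [MulAction H U] [SMulCommClass H Kᵐᵒᵖ U] :
    MulAction H (tU K U X) where
  one_smul f := Subtype.ext (funext fun u => by
    rw [tU_smul_def]; simp)
  mul_smul g h f := Subtype.ext (funext fun u => by
    rw [tU_smul_def, tU_smul_def, tU_smul_def, mul_inv_rev, mul_smul])

/-- For a subgroup `L ≤ H` and `u ∈ U`, the subgroup
`L^u = {k ∈ K : u·k = l·u for some l ∈ L}` of `K`. -/
def stabSub [MulAction H U] [SMulCommClass H Kᵐᵒᵖ U] (L : Subgroup H) (u : U) :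
    Subgroup K where
  carrier := {k : K | ∃ l ∈ L, op k • u = l • u}
  one_mem' := ⟨1, L.one_mem, by simp⟩
  mul_mem' := fun {a b} ha hb => by
    obtain ⟨l₁, hl₁, h₁⟩ := ha
    obtain ⟨l₂, hl₂, h₂⟩ := hb
    refine ⟨l₁ * l₂, L.mul_mem hl₁ hl₂, ?_⟩
    rw [op_mul, mul_smul, h₁, ← smul_comm, h₂, ← mul_smul]
  inv_mem' := fun {a} ha => by
    obtain ⟨l, hl, h⟩ := ha
    refine ⟨l⁻¹, L.inv_mem hl, ?_⟩
    have h2 : l⁻¹ • u = (op a)⁻¹ • u := by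
      rw [inv_smul_eq_iff, smul_comm, ← h, inv_smul_smul]
    rw [op_inv]
    exact h2.symm

theorem withBot_smul_mono {K X : Type u} [Group K] [PartialOrder X] [MulAction K X]
    (hmono : ∀ k : K, Monotone (fun x : X => k • x)) (k : K) :
    Monotone (fun x : WithBot X => k • x) :=
  (hmono k).withBot_map

/-- An `L`-fixed element of `t_U(cX)` is determined on the `(L,K)`-orbit of `v` by its value
at `v`. -/
theorem tU_apply_of_fixed {H K U X : Type u} [Group H] [Group K] [MulAction H U]
    [MulAction Kᵐᵒᵖ U] [SMulCommClass H Kᵐᵒᵖ U] [PartialOrder X] [MulAction K X]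
    {L : Subgroup H} {f : tU K U X} (hf : ∀ l : H, l ∈ L → l • f = f)
    {l : H} (hl : l ∈ L) (k : K) (v : U) :
    f.1 (l • op k • v) = k⁻¹ • f.1 v := by
  have h : (l⁻¹ • f).1 (op k • v) = f.1 (op k • v) := by rw [hf _ (L.inv_mem hl)]
  rw [tU_smul_def, inv_inv, f.2] at h
  exact h

theorem smul_apply_of_mem_stabSub {H K U X : Type u} [Group H] [Group K] [MulAction H U]
    [MulAction Kᵐᵒᵖ U] [SMulCommClass H Kᵐᵒᵖ U] [PartialOrder X] [MulAction K X]
    {L : Subgroup H} {f : tU K U X} (hf : ∀ l : H, l ∈ L → l • f = f)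
    {v : U} {k : K} (hk : k ∈ stabSub H K U L v) :
    k • f.1 v = f.1 v := by
  obtain ⟨l, hl, h⟩ := hk
  have h' := tU_apply_of_fixed hf (L.inv_mem hl) k v
  rw [h, inv_smul_smul] at h'
  rw [eq_inv_smul_iff.mp h']

theorem mul_inv_mem_stabSub {H K U : Type u} [Group H] [Group K] [MulAction H U]
    [MulAction Kᵐᵒᵖ U] [SMulCommClass H Kᵐᵒᵖ U] {L : Subgroup H} {v : U} {l l' : H}
    (hl : l ∈ L) (hl' : l' ∈ L) {k k' : K} (h : l • op k • v = l' • op k' • v) :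
    k' * k⁻¹ ∈ stabSub H K U L v := by
  refine ⟨l'⁻¹ * l, L.mul_mem (L.inv_mem hl') hl, ?_⟩
  rw [op_mul, mul_smul, op_inv, inv_smul_eq_iff, ← smul_comm, mul_smul, h, inv_smul_smul]

/-- Every choice of values in `∏ (cX)^{L^{u i}}` on orbit representatives extends to an
`L`-fixed element of `t_U(cX)`. -/
theorem exists_fixed_tU_extension {ι : Type*} {H K U X : Type u} [Group H] [Group K]
    [MulAction H U] [MulAction Kᵐᵒᵖ U] [SMulCommClass H Kᵐᵒᵖ U] [PartialOrder X]
    [MulAction K X] {L : Subgroup H} {u : ι → U}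
    (hu : ∀ v : U, ∃! i : ι, ∃ l ∈ L, ∃ k : K, v = l • op k • u i)
    (g : ι → WithBot X) (hg : ∀ i, ∀ k ∈ stabSub H K U L (u i), k • g i = g i) :
    ∃ f : tU K U X, (∀ l : H, l ∈ L → l • f = f) ∧ ∀ i, f.1 (u i) = g i := by
  choose i hi huniq using hu
  choose l hl k hv using hi
  have key : ∀ (j : ι) (l' : H), l' ∈ L → ∀ k' : K,
      (k (l' • op k' • u j))⁻¹ • g (i (l' • op k' • u j)) = k'⁻¹ • g j := by
    intro j l' hl' k'
    have hj : j = i (l' • op k' • u j) := huniq _ j ⟨l', hl', k', rfl⟩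
    have h := hv (l' • op k' • u j)
    rw [← hj] at h ⊢
    have hs := hg j _ (mul_inv_mem_stabSub (hl _) hl' h.symm)
    rwa [mul_smul, ← eq_inv_smul_iff] at hs
  refine ⟨⟨fun v => (k v)⁻¹ • g (i v), fun v c => ?_⟩,
    fun a ha => Subtype.ext (funext fun v => ?_),
    fun j => ?_⟩
  · have h : op c • v = l v • op (k v * c) • u (i v) := by
      conv_lhs => rw [hv v]
      rw [op_mul, mul_smul, ← smul_comm]
    change (k (op c • v))⁻¹ • g (i (op c • v)) = _
    rw [h, key _ _ (hl v), mul_inv_rev, mul_smul]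
  · have h : a⁻¹ • v = (a⁻¹ * l v) • op (k v) • u (i v) := by
      conv_lhs => rw [hv v]
      rw [mul_smul]
    change (k (a⁻¹ • v))⁻¹ • g (i (a⁻¹ • v)) = (k v)⁻¹ • g (i v)
    rw [h, key _ _ (L.mul_mem (L.inv_mem ha) (hl v))]
  · simpa using key j 1 L.one_mem 1

theorem stmt14 (H K : Type) [Group H] [Group K] [Finite H] [Finite K]
    (U : Type) [Finite U] [MulAction H U] [MulAction Kᵐᵒᵖ U]
    [SMulCommClass H Kᵐᵒᵖ U]
    (X : Type) [PartialOrder X] [MulAction K X]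
    (hmono : ∀ kk : K, Monotone (fun x : X => kk • x))
    (L : Subgroup H) (r : ℕ) (u : Fin r → U)
    (hu : ∀ v : U, ∃! i : Fin r, ∃ l ∈ L, ∃ k : K, v = l • op k • u i) :
    ∃ e : {f : tU K U X // ∀ l : H, l ∈ L → l • f = f} ≃o
        ((i : Fin r) → {x : WithBot X // ∀ k : K, k ∈ stabSub H K U L (u i) →
          k • x = x}),
      ∀ f i, ((e f) i : WithBot X) = (f : tU K U X).1 (u i) := by
  let F (f : {f : tU K U X // ∀ l : H, l ∈ L → l • f = f}) (i : Fin r) :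
      {x : WithBot X // ∀ k : K, k ∈ stabSub H K U L (u i) → k • x = x} :=
    ⟨f.1.1 (u i), fun _ hk => smul_apply_of_mem_stabSub f.2 hk⟩
  have hle : ∀ f g, F f ≤ F g ↔ f ≤ g := by
    refine fun f g => ⟨fun h v => ?_, fun h i => h (u i)⟩
    obtain ⟨i, ⟨l, hl, k, rfl⟩, -⟩ := hu v
    rw [tU_apply_of_fixed f.2 hl, tU_apply_of_fixed g.2 hl]
    exact withBot_smul_mono hmono k⁻¹ (h i)
  have hsurj : Function.Surjective F := by
    intro g
    obtain ⟨f, hf, hfg⟩ := exists_fixed_tU_extension hu (fun i => (g i).1) fun i => (g i).2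
    exact ⟨⟨f, hf⟩, funext fun i => Subtype.ext (hfg i)⟩
  exact ⟨RelIso.ofSurjective (OrderEmbedding.ofMapLEIff F hle) hsurj, fun _ _ => rfl⟩
end

section
/- Let H, K, L be finite groups, U a finite (H,K)-biset, V a finite (L,H)-biset, and X a K-poset. Then there is an L-equivariant order isomorphism jn_V(jn_U X) ≅ jn_{V ×_H U} X, where V ×_H U is the (L,K)-biset obtained as the quotient of V × U by the relation (v·h, u) ∼ (v, h·u) for h ∈ H, with L acting on the first coordinate and K on the second. -/
open MulOpposite

universe u

variable (H K : Type u) [Group H] [Group K]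
variable (U : Type u) [MulAction Kᵐᵒᵖ U]
variable (X : Type u) [PartialOrder X] [MulAction K X]

/-- The constant map with value `0_X` in `t_U(cX)`. -/
def constBot : tU K U X := ⟨fun _ => ⊥, fun _ _ => rfl⟩

/-- The join induction `jn_U X := t_U(cX) ∖ {f₀}`. -/
def JnU : Type u := {f : tU K U X // f ≠ constBot K U X}

instance : PartialOrder (JnU K U X) := by unfold JnU; infer_instance

theorem smul_constBot {H : Type u} [Group H] [MulAction H U]
    [SMulCommClass H Kᵐᵒᵖ U] (h : H) :
    h • constBot K U X = constBot K U X :=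
  Subtype.ext (funext fun _ => rfl)

instance JnUSMul [MulAction H U] [SMulCommClass H Kᵐᵒᵖ U] :
    SMul H (JnU K U X) :=
  ⟨fun h f => ⟨h • f.1, fun hc => f.2 (by
    have h2 := congrArg (fun x => h⁻¹ • x) hc
    simpa [inv_smul_smul, smul_constBot] using h2)⟩⟩

instance JnUMulAction [MulAction H U] [SMulCommClass H Kᵐᵒᵖ U] :
    MulAction H (JnU K U X) where
  one_smul f := Subtype.ext (one_smul H f.1)
  mul_smul a b f := Subtype.ext (mul_smul a b f.1)

/-- The relation on `V × U` generated by `(v·h, u) ∼ (v, h·u)`: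
explicitly, `(v,u) ∼ (v',u')` iff `v' = v·h` and `u = h·u'` for some `h ∈ H`. -/
def bisetRel (H : Type u) [Group H] (V U : Type u) [MulAction Hᵐᵒᵖ V]
    [MulAction H U] : Setoid (V × U) where
  r a b := ∃ h : H, b.1 = op h • a.1 ∧ a.2 = h • b.2
  iseqv := by
    refine ⟨fun a => ⟨1, by simp⟩, ?_, ?_⟩
    · rintro a b ⟨h, h1, h2⟩
      refine ⟨h⁻¹, ?_, ?_⟩
      · rw [h1, op_inv, inv_smul_smul]
      · rw [h2, inv_smul_smul]
    · rintro a b c ⟨h, h1, h2⟩ ⟨h', h1', h2'⟩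
      refine ⟨h * h', ?_, ?_⟩
      · rw [h1', h1, op_mul, mul_smul]
      · rw [h2, h2', mul_smul]

/-- The `(L,K)`-biset `V ×_H U`: the quotient of `V × U` by the relation
`(v·h, u) ∼ (v, h·u)`. -/
def QB (H : Type u) [Group H] (V U : Type u) [MulAction Hᵐᵒᵖ V]
    [MulAction H U] : Type u :=
  Quotient (bisetRel H V U)

section QB

variable {L H' K' : Type u} [Group L] [Group H'] [Group K']
variable {V U' : Type u} [MulAction H'ᵐᵒᵖ V] [MulAction H' U']

/-- The left action of `L` on `V ×_H U` (acting on the first coordinate). -/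
instance QBLeftSMul [MulAction L V] [SMulCommClass L H'ᵐᵒᵖ V] :
    SMul L (QB H' V U') :=
  ⟨fun l => Quotient.map (fun a => (l • a.1, a.2)) (by
    rintro a b ⟨h, h1, h2⟩
    exact ⟨h, by dsimp only; rw [h1, smul_comm], h2⟩)⟩

instance QBLeftMulAction [MulAction L V] [SMulCommClass L H'ᵐᵒᵖ V] :
    MulAction L (QB H' V U') where
  one_smul q := by
    induction q using Quotient.inductionOn with
    | h a => exact congrArg (Quotient.mk _) (by simp)
  mul_smul x y q := by
    induction q using Quotient.inductionOn with
    | h a => exact congrArg (Quotient.mk _) (by simp [mul_smul])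

/-- The right action of `K` on `V ×_H U` (acting on the second coordinate). -/
instance QBRightSMul [MulAction K'ᵐᵒᵖ U'] [SMulCommClass H' K'ᵐᵒᵖ U'] :
    SMul K'ᵐᵒᵖ (QB H' V U') :=
  ⟨fun k => Quotient.map (fun a => (a.1, k • a.2)) (by
    rintro a b ⟨h, h1, h2⟩
    exact ⟨h, h1, by dsimp only; rw [h2]; exact (smul_comm h k b.2).symm⟩)⟩

instance QBRightMulAction [MulAction K'ᵐᵒᵖ U'] [SMulCommClass H' K'ᵐᵒᵖ U'] :
    MulAction K'ᵐᵒᵖ (QB H' V U') where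
  one_smul q := by
    induction q using Quotient.inductionOn with
    | h a => exact congrArg (Quotient.mk _) (by simp)
  mul_smul x y q := by
    induction q using Quotient.inductionOn with
    | h a => exact congrArg (Quotient.mk _) (by simp [mul_smul])

instance QBSMulComm [MulAction L V] [SMulCommClass L H'ᵐᵒᵖ V]
    [MulAction K'ᵐᵒᵖ U'] [SMulCommClass H' K'ᵐᵒᵖ U'] :
    SMulCommClass L K'ᵐᵒᵖ (QB H' V U') where
  smul_comm l k q := by
    induction q using Quotient.inductionOn with
    | h a => rfl

end QB

section Transitivity

theorem constBot_le (f : tU K U X) : constBot K U X ≤ f := fun _ => bot_le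

/-- Adjoining a bottom element to `jn_U X` recovers `t_U(cX)`. -/
noncomputable def withBotJnUOrderIso : WithBot (JnU K U X) ≃o tU K U X where
  toFun x := WithBot.recBotCoe (constBot K U X) Subtype.val x
  invFun f := by
    classical
    exact if h : f = constBot K U X then ⊥ else WithBot.some (⟨f, h⟩ : JnU K U X)
  left_inv x := by
    cases x with
    | bot => exact dif_pos rfl
    | coe a => exact dif_neg a.2
  right_inv f := by
    by_cases h : f = constBot K U X
    · simp only [dif_pos h]
      exact h.symm
    · simp only [dif_neg h]
      rfl
  map_rel_iff' := by
    intro x y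
    cases x with
    | bot => exact ⟨fun _ => bot_le, fun _ => constBot_le K U X _⟩
    | coe a =>
      cases y with
      | bot =>
        refine ⟨fun h => absurd (le_antisymm h (constBot_le K U X _)) a.2, fun h => ?_⟩
        exact absurd h (WithBot.not_coe_le_bot a)
      | coe b => exact (WithBot.coe_le_coe (a := a) (b := b)).symm

theorem withBotJnUOrderIso_smul [MulAction H U] [SMulCommClass H Kᵐᵒᵖ U] (h : H)
    (x : WithBot (JnU K U X)) :
    withBotJnUOrderIso K U X (h • x) = h • withBotJnUOrderIso K U X x := by
  cases x with
  | bot => exact (smul_constBot K U X h).symm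
  | coe a => rfl

theorem withBotJnUOrderIso_symm_smul [MulAction H U] [SMulCommClass H Kᵐᵒᵖ U] (h : H)
    (f : tU K U X) :
    (withBotJnUOrderIso K U X).symm (h • f) = h • (withBotJnUOrderIso K U X).symm f := by
  rw [OrderIso.symm_apply_eq, withBotJnUOrderIso_smul, OrderIso.apply_symm_apply]

variable (V : Type u) [MulAction Hᵐᵒᵖ V] [MulAction H U] [SMulCommClass H Kᵐᵒᵖ U]

/-- Currying: `t_V(c(jn_U X))` is `t_{V ×_H U}(cX)`. -/
noncomputable def tUQBOrderIso : tU H V (JnU K U X) ≃o tU K (QB H V U) X where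
  toFun f := ⟨Quotient.lift (fun a => (withBotJnUOrderIso K U X (f.1 a.1)).1 a.2) (by
      rintro ⟨v, u⟩ ⟨v', u'⟩ ⟨h, h1, h2⟩
      dsimp only at h1 h2 ⊢
      rw [h1, h2, f.2, withBotJnUOrderIso_smul, tU_smul_def, inv_inv]), by
    intro q k
    induction q using Quotient.inductionOn with
    | h a => exact (withBotJnUOrderIso K U X (f.1 a.1)).2 a.2 k⟩
  invFun g := ⟨fun v => (withBotJnUOrderIso K U X).symm
      ⟨fun u => g.1 (Quotient.mk (bisetRel H V U) (v, u)),
        fun u k => g.2 (Quotient.mk (bisetRel H V U) (v, u)) k⟩, by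
    intro v h
    refine Eq.trans ?_ (withBotJnUOrderIso_symm_smul H K U X h⁻¹ _)
    refine congrArg (withBotJnUOrderIso K U X).symm (Subtype.ext (funext fun u => congrArg g.1 ?_))
    refine Quotient.sound (s := bisetRel H V U) ⟨h⁻¹, ?_, ?_⟩
    · simp
    · simp⟩
  left_inv f := Subtype.ext (funext fun v => (OrderIso.symm_apply_eq _).2 rfl)
  right_inv g := by
    refine Subtype.ext (funext fun q => ?_)
    induction q using Quotient.inductionOn with
    | h a =>
      exact congrFun (congrArg Subtype.val
        ((withBotJnUOrderIso K U X).apply_symm_apply _)) a.2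
  map_rel_iff' := by
    intro f g
    refine ⟨fun h v => ?_, fun h q => ?_⟩
    · rw [← (withBotJnUOrderIso K U X).le_iff_le]
      exact fun u => h (Quotient.mk (bisetRel H V U) (v, u))
    · induction q using Quotient.inductionOn with
      | h a => exact (withBotJnUOrderIso K U X).monotone (h a.1) a.2

theorem tUQBOrderIso_constBot :
    tUQBOrderIso H K U X V (constBot H V (JnU K U X)) = constBot K (QB H V U) X := by
  refine Subtype.ext (funext fun q => ?_)
  induction q using Quotient.inductionOn with
  | h a => rfl

theorem tUQBOrderIso_smul {L : Type u} [Group L] [MulAction L V] [SMulCommClass L Hᵐᵒᵖ V]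
    (l : L) (f : tU H V (JnU K U X)) :
    tUQBOrderIso H K U X V (l • f) = l • tUQBOrderIso H K U X V f := by
  refine Subtype.ext (funext fun q => ?_)
  induction q using Quotient.inductionOn with
  | h a => rfl

/-- Join induction is transitive: `jn_V (jn_U X)` is `jn_{V ×_H U} X`. -/
noncomputable def jnUQBOrderIso : JnU H V (JnU K U X) ≃o JnU K (QB H V U) X where
  toEquiv := (tUQBOrderIso H K U X V).toEquiv.subtypeEquiv fun f => by
    rw [← tUQBOrderIso_constBot H K U X V]
    exact (tUQBOrderIso H K U X V).injective.ne_iff.symm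
  map_rel_iff' := (tUQBOrderIso H K U X V).le_iff_le

end Transitivity

theorem stmt16 (L H K : Type) [Group L] [Group H] [Group K]
    [Finite L] [Finite H] [Finite K]
    (U : Type) [Finite U] [MulAction H U] [MulAction Kᵐᵒᵖ U]
    [SMulCommClass H Kᵐᵒᵖ U]
    (V : Type) [Finite V] [MulAction L V] [MulAction Hᵐᵒᵖ V]
    [SMulCommClass L Hᵐᵒᵖ V]
    (X : Type) [PartialOrder X] [MulAction K X]
    (hmono : ∀ kk : K, Monotone (fun x : X => kk • x)) :
    ∃ e : JnU H V (JnU K U X) ≃o JnU K (QB H V U) X,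
      ∀ (l : L) (f : JnU H V (JnU K U X)), e (l • f) = l • e f := by
  exact ⟨jnUQBOrderIso H K U X V,
    fun l f => Subtype.ext (tUQBOrderIso_smul H K U X V l f.1)⟩
end
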